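/- MNAR recovery by admissible factorization (Example 4): let X and Y be partially observed random variables with missingness indicators R_X, R_Y and proxies X*, Y*. If Y is conditionally independent of (R_X, R_Y) given X, and X is independent of R_X, then for all values x, y with P(X = x, R_X = 0, R_Y = 0) > 0 one has P(X = x, Y = y) = P(Y* = some y | X* = some x, R_X = 0, R_Y = 0) · P(X* = some x | R_X = 0). -/

import Mathlib

open MeasureTheory

/-- Elementary conditional probability `P(A | B)`. -/
noncomputable def cpr {Ω : Type*} [MeasurableSpace Ω] (P : Measure Ω) (A B : Set Ω) : ENNReal :=
  P (A ∩ B) / P B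

/-- Proxy variable: `X* = some X` when the indicator is `false` (observed, `R = 0`),
and `X* = none` when the indicator is `true` (missing, `R = 1`). -/
def proxy {Ω α : Type*} (X : Ω → α) (R : Ω → Bool) (ω : Ω) : Option α :=
  if R ω = false then some (X ω) else none

theorem proxy_eq_some_iff {Ω α : Type*} {X : Ω → α} {R : Ω → Bool} {ω : Ω} {x : α} :
    proxy X R ω = some x ↔ R ω = false ∧ X ω = x := by
  simp [proxy]

/-- If `d / a = (b / a) * (c / a)`, then `b = (d / c) * a`, for finite nonzero `a` and `c`. -/
theorem ENNReal.eq_div_mul_of_div_eq_div_mul_div {a b c d : ENNReal}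
    (ha : a ≠ 0) (ha' : a ≠ ⊤) (hc : c ≠ 0) (hc' : c ≠ ⊤)
    (h : d / a = b / a * (c / a)) : b = d / c * a := by
  have hd : d = b / a * c := by
    calc d = d / a * a := (ENNReal.div_mul_cancel ha ha').symm
      _ = b / a * (c / a * a) := by rw [h, mul_assoc]
      _ = b / a * c := by rw [ENNReal.div_mul_cancel ha ha']
  rw [hd, ENNReal.mul_div_cancel_right hc hc', ENNReal.div_mul_cancel ha ha']

/-- **MNAR recovery by admissible factorization (Example 4).**
`X`, `Y` are partially observed with indicators `RX`, `RY` and proxies.  If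
`Y ⟂ (RX, RY) | X` and `X ⟂ RX`, then for all `x, y` with
`P(X = x, RX = 0, RY = 0) > 0`,
`P(X = x, Y = y) = P(Y* = some y | X* = some x, RX = 0, RY = 0) ⬝ P(X* = some x | RX = 0)`. -/
theorem mnar_admissible_factorization
    {Ω α β : Type*} [MeasurableSpace Ω]
    [Fintype α] [Nonempty α] [Fintype β] [Nonempty β]
    (P : Measure Ω) [IsProbabilityMeasure P]
    (X : Ω → α) (Y : Ω → β) (RX RY : Ω → Bool)
    -- Y is conditionally independent of (RX, RY) given X:
    (hCI : ∀ (y : β) (r : Bool × Bool) (x : α),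
      cpr P ({ω | Y ω = y} ∩ {ω | (RX ω, RY ω) = r}) {ω | X ω = x} =
        cpr P {ω | Y ω = y} {ω | X ω = x} *
          cpr P {ω | (RX ω, RY ω) = r} {ω | X ω = x})
    -- X is independent of RX:
    (hInd : ∀ (x : α) (r : Bool),
      P ({ω | X ω = x} ∩ {ω | RX ω = r}) = P {ω | X ω = x} * P {ω | RX ω = r}) :
    ∀ (x : α) (y : β), 0 < P {ω | X ω = x ∧ RX ω = false ∧ RY ω = false} →
      P {ω | X ω = x ∧ Y ω = y} =
        cpr P {ω | proxy Y RY ω = some y}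
            {ω | proxy X RX ω = some x ∧ RX ω = false ∧ RY ω = false} *
          cpr P {ω | proxy X RX ω = some x} {ω | RX ω = false} := by
  intro x y hpos
  have hc : P {ω | X ω = x ∧ RX ω = false ∧ RY ω = false} ≠ 0 := hpos.ne'
  have ha : P {ω | X ω = x} ≠ 0 :=
    (hpos.trans_le (measure_mono fun _ h => h.1)).ne'
  have he : P {ω | RX ω = false} ≠ 0 :=
    (hpos.trans_le (measure_mono fun _ h => h.2.1)).ne'
  have hX : cpr P {ω | proxy X RX ω = some x} {ω | RX ω = false} = P {ω | X ω = x} := by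
    have hset : {ω | proxy X RX ω = some x} ∩ {ω | RX ω = false} =
        {ω | X ω = x} ∩ {ω | RX ω = false} := by
      ext ω
      simp only [proxy_eq_some_iff, Set.mem_inter_iff, Set.mem_ofPred_eq]
      tauto
    rw [cpr, hset, hInd, ENNReal.mul_div_cancel_right he (measure_ne_top P _)]
  have hobs : {ω | proxy X RX ω = some x ∧ RX ω = false ∧ RY ω = false} =
      {ω | X ω = x ∧ RX ω = false ∧ RY ω = false} := by
    ext ω
    simp only [proxy_eq_some_iff, Set.mem_ofPred_eq]
    tauto
  rw [hX, hobs, cpr]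
  refine ENNReal.eq_div_mul_of_div_eq_div_mul_div ha (measure_ne_top P _) hc
    (measure_ne_top P _) ?_
  have hjoint : {ω | proxy Y RY ω = some y} ∩ {ω | X ω = x ∧ RX ω = false ∧ RY ω = false} =
      {ω | Y ω = y} ∩ {ω | (RX ω, RY ω) = (false, false)} ∩ {ω | X ω = x} := by
    ext ω
    simp only [proxy_eq_some_iff, Set.mem_inter_iff, Set.mem_ofPred_eq, Prod.mk.injEq]
    tauto
  have hXY : {ω | X ω = x ∧ Y ω = y} = {ω | Y ω = y} ∩ {ω | X ω = x} := by
    ext ω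
    exact and_comm
  have hXR : {ω | X ω = x ∧ RX ω = false ∧ RY ω = false} =
      {ω | (RX ω, RY ω) = (false, false)} ∩ {ω | X ω = x} := by
    ext ω
    simp only [Set.mem_inter_iff, Set.mem_ofPred_eq, Prod.mk.injEq]
    tauto
  rw [hjoint, hXY, hXR]
  exact hCI y (false, false) x
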